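/- Let U ∈ ℝ, let n ∈ ℤ, and set V = −U + sgn(n)·√|n|. Let u : ℝ^N → ℝ be any function taking values in {U, V}. Then for all x, y ∈ ℝ^N, sin²(π·(u(x) + u(y))²)·(u(y) − u(x)) = 0; i.e., u is a trivial solution for the conductivity k(u,v) = sin²(π(u+v)²). -/

import Mathlib

open Set

theorem sq_sign_mul_sqrt_abs (n : ℤ) :
    ((Int.sign n : ℝ) * Real.sqrt |(n : ℝ)|) ^ 2 = ((|n| : ℤ) : ℝ) := by
  rw [mul_pow, Real.sq_sqrt (abs_nonneg _), Int.cast_abs]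
  rcases lt_trichotomy n 0 with h | rfl | h
  · simp [Int.sign_eq_neg_one_of_neg h]
  · simp
  · simp [Int.sign_eq_one_of_pos h]

/-- **Two-valued trivial solutions for `k(u,v) = sin²(π(u+v)²)`** (Remark 3.3): for any
`U ∈ ℝ` and integer `n`, with `V = −U + sgn(n)√|n|`, every function taking values in
`{U, V}` satisfies `sin²(π(u(x)+u(y))²)·(u(y)−u(x)) = 0` for all `x, y`. -/
theorem sine_conductivity_two_valued_trivial_solution
    {N : ℕ} (hN : 1 ≤ N) (U : ℝ) (n : ℤ)
    (V : ℝ) (hV : V = -U + (Int.sign n : ℝ) * Real.sqrt |(n : ℝ)|)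
    (u : EuclideanSpace ℝ (Fin N) → ℝ)
    (hu : ∀ x, u x = U ∨ u x = V) :
    ∀ x y : EuclideanSpace ℝ (Fin N),
      Real.sin (Real.pi * (u x + u y) ^ 2) ^ 2 * (u y - u x) = 0 := by
  have hsin : Real.sin (Real.pi * (U + V) ^ 2) = 0 := by
    rw [hV, add_neg_cancel_left, sq_sign_mul_sqrt_abs, mul_comm]
    exact Real.sin_int_mul_pi _
  intro x y
  rcases hu x with hx | hx <;> rcases hu y with hy | hy <;> rw [hx, hy]
  · simp
  · simp [hsin]
  · simp [add_comm V U, hsin]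
  · simp
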